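/- arXiv:1510.08043 — 3 statements merged into one kernel-verified Lean document; each statement's English description precedes it below -/
import Mathlib

section
/- Let A > 0 and α ∈ ℝ, and let D be the diagonal linear map on the Heisenberg Lie algebra 𝔥₃ with D e₁ = (−αA²/8 − A) e₁, D e₂ = (A − 5αA²/8) e₂, D e₃ = (A − 5αA²/8) e₃. Then D is a derivation of 𝔥₃ if and only if α = 8/(3A). In particular, the left-invariant metric A θ¹⊗θ¹ + θ²⊗θ² + θ³⊗θ³ on the Heisenberg group is a steady algebraic soliton for the second order renormalization group flow exactly when the coupling constant is α = 8/(3A). -/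
noncomputable section

/-- The bracket on the 3-dimensional real Lie algebra with Milnor-type structure constants
`⁅e₂, e₃⁆ = l1 • e₁`, `⁅e₃, e₁⁆ = l2 • e₂`, `⁅e₁, e₂⁆ = l3 • e₃` (indices `0, 1, 2`
stand for `e₁, e₂, e₃`). -/
def bra (l1 l2 l3 : ℝ) (x y : Fin 3 → ℝ) : Fin 3 → ℝ :=
  ![l1 * (x 1 * y 2 - x 2 * y 1),
    l2 * (x 2 * y 0 - x 0 * y 2),
    l3 * (x 0 * y 1 - x 1 * y 0)]

/-- The diagonal linear map sending `eᵢ ↦ t i • eᵢ`. -/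
def diagMap (t : Fin 3 → ℝ) (x : Fin 3 → ℝ) : Fin 3 → ℝ := fun i => t i * x i

/-- `D` is a derivation with respect to the bracket `br`. -/
def IsDerivation (br : (Fin 3 → ℝ) → (Fin 3 → ℝ) → (Fin 3 → ℝ))
    (D : (Fin 3 → ℝ) → (Fin 3 → ℝ)) : Prop :=
  ∀ x y, D (br x y) = br (D x) y + br x (D y)

/-- A diagonal map is a derivation of the Heisenberg Lie algebra iff its eigenvalue on the centre
is the sum of the other two. -/
theorem isDerivation_bra_one_zero_zero_diagMap_iff (t : Fin 3 → ℝ) :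
    IsDerivation (bra 1 0 0) (diagMap t) ↔ t 0 = t 1 + t 2 := by
  constructor
  · intro h
    simpa [bra, diagMap] using congrFun (h ![0, 1, 0] ![0, 0, 1]) 0
  · intro h x y
    ext i
    fin_cases i
    · simp [bra, diagMap, h]
      ring
    · simp [bra, diagMap]
    · simp [bra, diagMap]

/-- For `A > 0`, the diagonal map on the Heisenberg Lie algebra with entries
`-αA²/8 - A, A - 5αA²/8, A - 5αA²/8` (the RG-2 operator of the metric
`A θ¹⊗θ¹ + θ²⊗θ² + θ³⊗θ³` with coupling constant `α`) is a derivation iff `α = 8/(3A)`: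
the metric is a steady algebraic soliton for the RG-2 flow exactly when `α = 8/(3A)`. -/
theorem heisenberg_rg2_soliton (A α : ℝ) (hA : 0 < A) :
    IsDerivation (bra 1 0 0)
      (diagMap ![-α * A ^ 2 / 8 - A, A - 5 * α * A ^ 2 / 8, A - 5 * α * A ^ 2 / 8]) ↔
    α = 8 / (3 * A) := by
  rw [isDerivation_bra_one_zero_zero_diagMap_iff, eq_div_iff (by positivity)]
  simp only [Matrix.cons_val]
  constructor
  · intro h
    refine mul_left_cancel₀ hA.ne' ?_
    linear_combination (8 / 3) * h
  · intro h
    linear_combination (3 / 8 * A) * h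
end
end

section
/- Let A, B, C > 0 and α > 0, set λ̃₁ = √(A/(BC)), λ̃₂ = √(B/(AC)), λ̃₃ = −√(C/(AB)), μ̃ᵢ = (λ̃₁+λ̃₂+λ̃₃)/2 − λ̃ᵢ, and Kₗ = λ̃ₗ μ̃ₗ − μ̃ₘ μ̃ₙ for (l,m,n) a cyclic permutation of (1,2,3). Then the diagonal linear map on 𝔰𝔩(2,ℝ) with D e₁ = (−2(K₂+K₃) − α(K₂²+K₃²)) e₁, D e₂ = (−2(K₃+K₁) − α(K₃²+K₁²)) e₂, D e₃ = (−2(K₁+K₂) − α(K₁²+K₂²)) e₃ is never a derivation of 𝔰𝔩(2,ℝ). Hence the universal cover of SL(2,ℝ) supports no left-invariant algebraic soliton giving rise to a self-similar solution of the second order renormalization group flow. -/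
noncomputable section

/-- The diagonal derivations of `𝔰𝔩(2,ℝ)` in a Milnor frame are trivial. -/
theorem eq_zero_of_isDerivation_diagMap {t₁ t₂ t₃ : ℝ}
    (h : IsDerivation (bra 1 1 (-1)) (diagMap ![t₁, t₂, t₃])) :
    t₁ = 0 ∧ t₂ = 0 ∧ t₃ = 0 := by
  have h₁ := congrFun (h ![0, 1, 0] ![0, 0, 1]) 0
  have h₂ := congrFun (h ![0, 0, 1] ![1, 0, 0]) 1
  have h₃ := congrFun (h ![1, 0, 0] ![0, 1, 0]) 2
  simp [bra, diagMap] at h₁ h₂ h₃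
  refine ⟨?_, ?_, ?_⟩ <;> linarith

/-- If `-2 x - α x ^ 2` sums to zero over each pair of three numbers, it vanishes at each. -/
theorem rg2_root {α x y z : ℝ} (hα : 0 < α)
    (h₁ : -2 * (y + z) - α * (y ^ 2 + z ^ 2) = 0)
    (h₂ : -2 * (z + x) - α * (z ^ 2 + x ^ 2) = 0)
    (h₃ : -2 * (x + y) - α * (x ^ 2 + y ^ 2) = 0) :
    x = 0 ∨ x = -2 / α := by
  have h : x * (α * x + 2) = 0 := by linarith
  refine (mul_eq_zero.mp h).imp_right fun h' => ?_
  rw [eq_div_iff hα.ne']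
  linarith

/-- Three numbers with nonzero pairwise sums cannot have `a b + c a - b c` and its cyclic
analogues all in `{0, k}` for a negative `k`. -/
theorem not_curvatures_zero_or_neg {a b c k : ℝ} (hk : k < 0)
    (hab : a + b ≠ 0) (hbc : b + c ≠ 0) (hca : c + a ≠ 0)
    (h₁ : a * b + c * a - b * c = 0 ∨ a * b + c * a - b * c = k)
    (h₂ : b * c + a * b - c * a = 0 ∨ b * c + a * b - c * a = k)
    (h₃ : c * a + b * c - a * b = 0 ∨ c * a + b * c - a * b = k) : False := by
  have n₁ : b * c ≤ 0 := by grind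
  have n₂ : c * a ≤ 0 := by grind
  have n₃ : a * b ≤ 0 := by grind
  have hprod : a * b * c = 0 := by
    have : (b * c) * (c * a) * (a * b) ≤ 0 :=
      mul_nonpos_of_nonneg_of_nonpos (mul_nonneg_of_nonpos_of_nonpos n₁ n₂) n₃
    nlinarith [sq_nonneg (a * b * c)]
  rcases mul_eq_zero.mp hprod with h | rfl
  · rcases mul_eq_zero.mp h with rfl | rfl <;> grind
  · grind

/-- For `A, B, C > 0`, `α > 0`, and the principal sectional curvatures
`K₁, K₂, K₃` of the metric `A θ¹⊗θ¹ + B θ²⊗θ² + C θ³⊗θ³` on the universal cover of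
`SL(2,ℝ)`, the diagonal map given by the RG-2 operator is never a derivation of `𝔰𝔩(2,ℝ)`:
no left-invariant algebraic soliton giving a self-similar RG-2 solution exists. -/
theorem sl2_no_rg2_soliton (A B C α l1 l2 l3 m1 m2 m3 K1 K2 K3 : ℝ)
    (hA : 0 < A) (hB : 0 < B) (hC : 0 < C) (hα : 0 < α)
    (hl1 : l1 = Real.sqrt (A / (B * C)))
    (hl2 : l2 = Real.sqrt (B / (A * C)))
    (hl3 : l3 = -Real.sqrt (C / (A * B)))
    (hm1 : m1 = (l1 + l2 + l3) / 2 - l1)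
    (hm2 : m2 = (l1 + l2 + l3) / 2 - l2)
    (hm3 : m3 = (l1 + l2 + l3) / 2 - l3)
    (hK1 : K1 = l1 * m1 - m2 * m3)
    (hK2 : K2 = l2 * m2 - m3 * m1)
    (hK3 : K3 = l3 * m3 - m1 * m2) :
    ¬ IsDerivation (bra 1 1 (-1))
        (diagMap ![-2 * (K2 + K3) - α * (K2 ^ 2 + K3 ^ 2),
                   -2 * (K3 + K1) - α * (K3 ^ 2 + K1 ^ 2),
                   -2 * (K1 + K2) - α * (K1 ^ 2 + K2 ^ 2)]) := by
  intro h
  obtain ⟨e₁, e₂, e₃⟩ := eq_zero_of_isDerivation_diagMap h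
  have p₁ : 0 < l1 := hl1 ▸ Real.sqrt_pos.mpr (by positivity)
  have p₂ : 0 < l2 := hl2 ▸ Real.sqrt_pos.mpr (by positivity)
  have p₃ : l3 < 0 := hl3 ▸ neg_neg_of_pos (Real.sqrt_pos.mpr (by positivity))
  have s₁ : m2 + m3 = l1 := by rw [hm2, hm3]; ring
  have s₂ : m3 + m1 = l2 := by rw [hm3, hm1]; ring
  have s₃ : m1 + m2 = l3 := by rw [hm1, hm2]; ring
  have c₁ : m1 * m2 + m3 * m1 - m2 * m3 = K1 := by rw [hK1, ← s₁]; ring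
  have c₂ : m2 * m3 + m1 * m2 - m3 * m1 = K2 := by rw [hK2, ← s₂]; ring
  have c₃ : m3 * m1 + m2 * m3 - m1 * m2 = K3 := by rw [hK3, ← s₃]; ring
  refine not_curvatures_zero_or_neg (a := m1) (b := m2) (c := m3)
    (div_neg_of_neg_of_pos (by norm_num : (-2 : ℝ) < 0) hα)
    (s₃ ▸ p₃.ne) (s₁ ▸ p₁.ne') (s₂ ▸ p₂.ne') ?_ ?_ ?_
  · rw [c₁]; exact rg2_root hα e₁ e₂ e₃
  · rw [c₂]; exact rg2_root hα e₂ e₃ e₁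
  · rw [c₃]; exact rg2_root hα e₃ e₁ e₂
end
end

section
/- Let A, B, C > 0, let α ∈ ℝ, and set K₁ = −(3A² − B² + 2BC − C² − 2AB − 2AC)/(4ABC), K₂ = (A² − 3B² + C² + 2AB + 2BC − 2AC)/(4ABC), K₃ = (A² + B² − 3C² − 2AB + 2BC + 2AC)/(4ABC). Then the diagonal linear map on 𝔰𝔲(2) with D e₁ = (−2(K₂+K₃) − α(K₂²+K₃²)) e₁, D e₂ = (−2(K₃+K₁) − α(K₃²+K₁²)) e₂, D e₃ = (−2(K₁+K₂) − α(K₁²+K₂²)) e₃ is a derivation of 𝔰𝔲(2) if and only if one of the following holds: (1) A = B = C and α = −8A; (2) A = (4/3)B = (4/3)C and α = −(9/2)A; (3) A = B = (3/4)C and α = −6A; (4) A = C = (3/4)B and α = −6A. -/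
noncomputable section

/-- A diagonal map is a derivation of `𝔰𝔲(2)` if and only if it vanishes. -/
lemma isDerivation_bra_one_diagMap_iff (t : Fin 3 → ℝ) :
    IsDerivation (bra 1 1 1) (diagMap t) ↔ t 0 = 0 ∧ t 1 = 0 ∧ t 2 = 0 := by
  constructor
  · intro h
    have h0 := congrFun (h ![0, 1, 0] ![0, 0, 1]) 0
    have h1 := congrFun (h ![0, 0, 1] ![1, 0, 0]) 1
    have h2 := congrFun (h ![1, 0, 0] ![0, 1, 0]) 2
    simp [bra, diagMap] at h0 h1 h2
    refine ⟨?_, ?_, ?_⟩ <;> linarith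
  · rintro ⟨h0, h1, h2⟩ x y
    ext i
    fin_cases i <;> simp [bra, diagMap, h0, h1, h2]

/-- The sectional curvature of `SU(2)` along the first axis, up to the positive factor
`1 / (4xyz)`, for the metric with Milnor frame coefficients `x, y, z`. -/
def curvNum (x y z : ℝ) : ℝ := -3 * x ^ 2 + (y - z) ^ 2 + 2 * x * (y + z)

lemma curvNum_swap (x y z : ℝ) : curvNum x z y = curvNum x y z := by
  unfold curvNum; ring

lemma curvNum_eq_cases {x y z : ℝ} (h : curvNum x y z = curvNum y x z) :
    x = y ∨ z = x + y := by
  have h' : (x - y) * (z - (x + y)) = 0 := by unfold curvNum at h; linarith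
  rcases mul_eq_zero.1 h' with h | h
  · exact Or.inl (sub_eq_zero.1 h)
  · exact Or.inr (sub_eq_zero.1 h)

lemma curvNum_not_both_zero {x y z : ℝ} (hx : 0 < x) (hy : 0 < y) (hz : 0 < z)
    (h1 : curvNum x y z = 0) (h2 : curvNum y x z = 0) : False := by
  rcases curvNum_eq_cases (h1.trans h2.symm) with rfl | rfl
  · have : z * z = 0 := by unfold curvNum at h1; linarith
    exact (mul_pos hz hz).ne' this
  · have : x * y = 0 := by unfold curvNum at h1; linarith
    exact (mul_pos hx hy).ne' this

lemma eq_of_curvNum_eq_zero {x y z : ℝ} (hx : 0 < x) (hy : 0 < y) (hz : 0 < z)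
    (h1 : curvNum x y z = 0) (h2 : curvNum y x z = curvNum z x y) : y = z ∧ 3 * x = 4 * y := by
  rw [curvNum_swap y z x, curvNum_swap z y x] at h2
  rcases curvNum_eq_cases h2 with rfl | rfl
  · refine ⟨rfl, ?_⟩
    have : x * (3 * x - 4 * y) = 0 := by unfold curvNum at h1; linarith
    rcases mul_eq_zero.1 this with h | h <;> linarith
  · have : y * z = 0 := by unfold curvNum at h1; linarith
    exact absurd this (mul_pos hy hz).ne'

lemma eq_of_curvNum_eq {x y z : ℝ} (hx : 0 < x) (hy : 0 < y) (hz : 0 < z)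
    (h1 : curvNum x y z = curvNum y x z) (h2 : curvNum x y z = curvNum z x y) :
    x = y ∧ x = z := by
  rcases curvNum_eq_cases h1 with rfl | rfl
  · rw [curvNum_swap x z x] at h2
    rcases curvNum_eq_cases h2 with h | h
    · exact ⟨rfl, h⟩
    · linarith
  · have : x * y = 0 := by unfold curvNum at h2; linarith
    exact absurd this (mul_pos hx hy).ne'

/-- For `A, B, C > 0`, `α : ℝ`, and the principal sectional curvatures
`K₁, K₂, K₃` of the metric `A θ¹⊗θ¹ + B θ²⊗θ² + C θ³⊗θ³` on `SU(2)`, the diagonal map given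
by the RG-2 operator is a derivation of `𝔰𝔲(2)` iff one of: (1) `A = B = C` and `α = -8A`;
(2) `A = (4/3)B = (4/3)C` and `α = -(9/2)A`; (3) `A = B = (3/4)C` and `α = -6A`;
(4) `A = C = (3/4)B` and `α = -6A`. -/
theorem su2_rg2_soliton_iff (A B C α K1 K2 K3 : ℝ) (hA : 0 < A) (hB : 0 < B) (hC : 0 < C)
    (hK1 : K1 = -(3 * A ^ 2 - B ^ 2 + 2 * B * C - C ^ 2 - 2 * A * B - 2 * A * C) / (4 * A * B * C))
    (hK2 : K2 = (A ^ 2 - 3 * B ^ 2 + C ^ 2 + 2 * A * B + 2 * B * C - 2 * A * C) / (4 * A * B * C))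
    (hK3 : K3 = (A ^ 2 + B ^ 2 - 3 * C ^ 2 - 2 * A * B + 2 * B * C + 2 * A * C) / (4 * A * B * C)) :
    IsDerivation (bra 1 1 1)
      (diagMap ![-2 * (K2 + K3) - α * (K2 ^ 2 + K3 ^ 2),
                 -2 * (K3 + K1) - α * (K3 ^ 2 + K1 ^ 2),
                 -2 * (K1 + K2) - α * (K1 ^ 2 + K2 ^ 2)]) ↔
      ((A = B ∧ B = C ∧ α = -8 * A) ∨
       (A = (4 / 3) * B ∧ A = (4 / 3) * C ∧ α = -(9 / 2) * A) ∨
       (A = B ∧ A = (3 / 4) * C ∧ α = -6 * A) ∨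
       (A = C ∧ A = (3 / 4) * B ∧ α = -6 * A)) := by
  have hD : 0 < 4 * A * B * C := by positivity
  have e1 : K1 = curvNum A B C / (4 * A * B * C) := by rw [hK1, curvNum]; ring
  have e2 : K2 = curvNum B A C / (4 * A * B * C) := by rw [hK2, curvNum]; ring
  have e3 : K3 = curvNum C A B / (4 * A * B * C) := by rw [hK3, curvNum]; ring
  rw [isDerivation_bra_one_diagMap_iff]
  constructor
  · rintro ⟨h0, h1, h2⟩
    simp only [Matrix.cons_val] at h0 h1 h2
    clear hK1 hK2 hK3
    have cases_of {K n : ℝ} (hK : K = n / (4 * A * B * C)) (h : K * (2 + α * K) = 0) :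
        n = 0 ∨ α * n = -2 * (4 * A * B * C) := by
      rw [eq_div_iff hD.ne'] at hK
      rcases mul_eq_zero.1 h with h | h
      · left; rw [← hK, h, zero_mul]
      · right; rw [← hK]; linear_combination (4 * A * B * C) * h
    have eq_of {m n : ℝ} (hm : α * m = -2 * (4 * A * B * C))
        (hn : α * n = -2 * (4 * A * B * C)) : m = n := by
      have hα : α ≠ 0 := by rintro rfl; linarith
      exact mul_left_cancel₀ hα (hm.trans hn.symm)
    rcases cases_of e1 (by linarith) with c1 | c1 <;>
    rcases cases_of e2 (by linarith) with c2 | c2 <;>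
    rcases cases_of e3 (by linarith) with c3 | c3
    · exact (curvNum_not_both_zero hA hB hC c1 c2).elim
    · exact (curvNum_not_both_zero hA hB hC c1 c2).elim
    · exact (curvNum_not_both_zero hA hC hB (curvNum_swap A B C ▸ c1) c3).elim
    · obtain ⟨rfl, h⟩ := eq_of_curvNum_eq_zero hA hB hC c1 (eq_of c2 c3)
      obtain rfl : B = 3 / 4 * A := by linarith
      refine Or.inr (Or.inl ⟨by ring, by ring, mul_right_cancel₀ (pow_pos hA 2).ne' ?_⟩)
      unfold curvNum at c2
      linear_combination c2
    · exact (curvNum_not_both_zero hB hC hA (curvNum_swap B A C ▸ c2)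
        (curvNum_swap C A B ▸ c3)).elim
    · obtain ⟨rfl, h⟩ := eq_of_curvNum_eq_zero hB hA hC c2
        ((eq_of c1 c3).trans (curvNum_swap C B A))
      obtain rfl : B = 4 / 3 * A := by linarith
      refine Or.inr (Or.inr (Or.inr ⟨rfl, by ring, mul_right_cancel₀ (pow_pos hA 2).ne' ?_⟩))
      unfold curvNum at c1
      linear_combination (9 / 16) * c1
    · obtain ⟨rfl, h⟩ := eq_of_curvNum_eq_zero hC hA hB c3
        ((curvNum_swap A B C).trans ((eq_of c1 c2).trans (curvNum_swap B C A)))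
      obtain rfl : C = 4 / 3 * A := by linarith
      refine Or.inr (Or.inr (Or.inl ⟨rfl, by ring, mul_right_cancel₀ (pow_pos hA 2).ne' ?_⟩))
      unfold curvNum at c1
      linear_combination (9 / 16) * c1
    · obtain ⟨rfl, rfl⟩ := eq_of_curvNum_eq hA hB hC (eq_of c1 c2) (eq_of c1 c3)
      refine Or.inl ⟨rfl, rfl, mul_right_cancel₀ (pow_pos hA 2).ne' ?_⟩
      unfold curvNum at c1
      linear_combination c1
  · clear hK1 hK2 hK3
    simp only [Matrix.cons_val]
    have curv_zero {K n : ℝ} (hK : K = n / (4 * A * B * C))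
        (h : n = 0 ∨ α * n = -2 * (4 * A * B * C)) : 2 * K + α * K ^ 2 = 0 := by
      rcases h with rfl | h
      · simp [hK]
      · have : α * K = -2 := by rw [hK, ← mul_div_assoc, h, mul_div_assoc, div_self hD.ne', mul_one]
        linear_combination K * this
    intro hcases
    suffices h : (2 * K1 + α * K1 ^ 2 = 0) ∧ (2 * K2 + α * K2 ^ 2 = 0) ∧
        (2 * K3 + α * K3 ^ 2 = 0) by
      obtain ⟨h1, h2, h3⟩ := h
      refine ⟨?_, ?_, ?_⟩ <;> linarith
    rcases hcases with (⟨rfl, rfl, rfl⟩ | ⟨hAB, hAC, rfl⟩ | ⟨rfl, hAC, rfl⟩ | ⟨rfl, hAB, rfl⟩)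
    · refine ⟨curv_zero e1 (Or.inr ?_), curv_zero e2 (Or.inr ?_), curv_zero e3 (Or.inr ?_)⟩ <;>
        unfold curvNum <;> ring
    · obtain rfl : B = 3 / 4 * A := by linarith
      obtain rfl : C = 3 / 4 * A := by linarith
      refine ⟨curv_zero e1 (Or.inl ?_), curv_zero e2 (Or.inr ?_), curv_zero e3 (Or.inr ?_)⟩ <;>
        unfold curvNum <;> ring
    · obtain rfl : C = 4 / 3 * A := by linarith
      refine ⟨curv_zero e1 (Or.inr ?_), curv_zero e2 (Or.inr ?_), curv_zero e3 (Or.inl ?_)⟩ <;>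
        unfold curvNum <;> ring
    · obtain rfl : B = 4 / 3 * A := by linarith
      refine ⟨curv_zero e1 (Or.inr ?_), curv_zero e2 (Or.inl ?_), curv_zero e3 (Or.inr ?_)⟩ <;>
        unfold curvNum <;> ring
end
end
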